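/- arXiv:2005.13620 — 2 statements merged into one kernel-verified Lean document; each statement's English description precedes it below -/
import Mathlib

section
/- For |q| < 1, the triple sum ∑_{n₁,n₂,n₃≥0} q^{n₁+n₂+n₃+n₁n₂+n₂n₃} / ((q;q)_{n₁}² (q;q)_{n₂}² (q;q)_{n₃}²) equals (∑_{n∈ℤ} sgn(n) q^{3n²+2n}) / (q;q)_∞⁴, where sgn(0)=1. -/
/-- The finite q-Pochhammer symbol `(q;q)_n`. -/
noncomputable def qPoch (q : ℂ) (n : ℕ) : ℂ := ∏ i ∈ Finset.range n, (1 - q ^ (i + 1))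

/-- The infinite q-Pochhammer symbol `(q;q)_∞`. -/
noncomputable def qPochInf (q : ℂ) : ℂ := ∏' i : ℕ, (1 - q ^ (i + 1))

/-- The infinite q-Pochhammer symbol `(a;q)_∞ = ∏_{i≥0} (1 - a q^i)`. -/
noncomputable def pochInf (a q : ℂ) : ℂ := ∏' i : ℕ, (1 - a * q ^ i)

theorem qPoch_succ (q : ℂ) (n : ℕ) : qPoch q (n+1) = qPoch q n * (1 - q^(n+1)) := by
  simp [qPoch, Finset.prod_range_succ]

theorem qPoch_zero (q : ℂ) : qPoch q 0 = 1 := by simp [qPoch]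

theorem one_sub_ne {q : ℂ} (hq : ‖q‖ < 1) (n : ℕ) : 1 - q^(n+1) ≠ 0 := by
  intro h
  have h1 : q^(n+1) = 1 := (sub_eq_zero.mp h).symm
  have h2 : ‖q‖^(n+1) = 1 := by rw [← norm_pow, h1, norm_one]
  have h3 : ‖q‖^(n+1) < 1 := pow_lt_one₀ (norm_nonneg _) hq (by omega)
  linarith

theorem qPoch_ne {q : ℂ} (hq : ‖q‖ < 1) (n : ℕ) : qPoch q n ≠ 0 :=
  Finset.prod_ne_zero_iff.mpr fun i _ => one_sub_ne hq i

theorem summable_aux {q : ℂ} (hq : ‖q‖ < 1) : Summable fun i : ℕ => ‖-q^(i+1)‖ := by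
  have := (summable_geometric_of_lt_one (norm_nonneg q) hq)
  simpa using (summable_nat_add_iff 1).mpr this

theorem qPochInf_ne {q : ℂ} (hq : ‖q‖ < 1) : qPochInf q ≠ 0 := by
  have := tprod_one_add_ne_zero_of_summable (f := fun i : ℕ => -q^(i+1))
    (fun i => by simpa [sub_eq_add_neg] using one_sub_ne hq i) (summable_aux hq)
  simpa [qPochInf, sub_eq_add_neg] using this

theorem qPoch_tendsto {q : ℂ} (hq : ‖q‖ < 1) :
    Filter.Tendsto (qPoch q) Filter.atTop (nhds (qPochInf q)) := by
  have := (multipliable_one_add_of_summable (summable_aux hq)).tendsto_prod_tprod_nat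
  have e : qPoch q = fun n => ∏ i ∈ Finset.range n, (1 + -q ^ (i + 1)) := by
    funext n; simp [qPoch, sub_eq_add_neg]
  rw [e]
  simpa [qPochInf, sub_eq_add_neg] using this

def Bd {ι : Type} (c : ι → ℂ) : Prop := ∃ K : ℝ, ∀ i, ‖c i‖ ≤ K

theorem Bd.mul {ι : Type} {c d : ι → ℂ} (hc : Bd c) (hd : Bd d) : Bd (fun i => c i * d i) := by
  obtain ⟨K, hK⟩ := hc
  obtain ⟨L, hL⟩ := hd
  refine ⟨K * L, fun i => ?_⟩
  rw [norm_mul]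
  exact mul_le_mul (hK i) (hL i) (norm_nonneg _) ((norm_nonneg _).trans (hK i))

theorem Bd.comp {ι κ : Type} {c : κ → ℂ} (hc : Bd c) (g : ι → κ) : Bd (fun i => c (g i)) := by
  obtain ⟨K, hK⟩ := hc
  exact ⟨K, fun i => hK _⟩

theorem Bd.const {ι : Type} (x : ℂ) : Bd (fun _ : ι => x) := ⟨‖x‖, fun _ => le_rfl⟩

theorem Bd.sign {ι : Type} (e : ι → ℕ) : Bd (fun i => (-1 : ℂ) ^ e i) :=
  ⟨1, fun i => by simp⟩

theorem Bd.of_tendsto {c : ℕ → ℂ} {x : ℂ} (h : Filter.Tendsto c Filter.atTop (nhds x)) : Bd c := by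
  obtain ⟨K, hK⟩ := (Metric.isBounded_range_of_tendsto c h).exists_norm_le
  exact ⟨K, fun i => hK _ ⟨i, rfl⟩⟩

theorem Bd.P {ι : Type} {q : ℂ} (hq : ‖q‖ < 1) (g : ι → ℕ) : Bd (fun i => qPoch q (g i)) :=
  (Bd.of_tendsto (qPoch_tendsto hq)).comp g

theorem Bd.I {ι : Type} {q : ℂ} (hq : ‖q‖ < 1) (g : ι → ℕ) : Bd (fun i => (qPoch q (g i))⁻¹) :=
  (Bd.of_tendsto ((qPoch_tendsto hq).inv₀ (qPochInf_ne hq))).comp g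

theorem term_le {q : ℂ} (hq : ‖q‖ < 1) {K : ℝ} {c : ℂ} (hc : ‖c‖ ≤ K) {a e : ℕ} (h : a ≤ e) :
    ‖q^e * c‖ ≤ ‖q‖^a * K := by
  rw [norm_mul, norm_pow]
  exact mul_le_mul (pow_le_pow_of_le_one (norm_nonneg _) hq.le h) hc (norm_nonneg _)
    (by positivity)

theorem summ1 {q : ℂ} (hq : ‖q‖ < 1) {c : ℕ → ℂ} (hc : Bd c) {e : ℕ → ℕ} (he : ∀ n, n ≤ e n) :
    Summable fun n => q^(e n) * c n := by
  obtain ⟨K, hK⟩ := hc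
  exact Summable.of_norm_bounded
    ((summable_geometric_of_lt_one (norm_nonneg q) hq).mul_right K)
    fun n => term_le hq (hK n) (he n)

theorem summ2 {q : ℂ} (hq : ‖q‖ < 1) {c : ℕ × ℕ → ℂ} (hc : Bd c) {e : ℕ × ℕ → ℕ}
    (he : ∀ n, n.1 + n.2 ≤ e n) :
    Summable fun n => q^(e n) * c n := by
  obtain ⟨K, hK⟩ := hc
  have g := summable_geometric_of_lt_one (norm_nonneg q) hq
  refine Summable.of_norm_bounded
    ((g.mul_of_nonneg g (fun _ => by positivity) (fun _ => by positivity)).mul_right K)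
    fun n => (term_le hq (hK n) (he n)).trans ?_
  rw [pow_add]

theorem summ3 {q : ℂ} (hq : ‖q‖ < 1) {c : ℕ × ℕ × ℕ → ℂ} (hc : Bd c) {e : ℕ × ℕ × ℕ → ℕ}
    (he : ∀ n, n.1 + n.2.1 + n.2.2 ≤ e n) :
    Summable fun n => q^(e n) * c n := by
  obtain ⟨K, hK⟩ := hc
  have g := summable_geometric_of_lt_one (norm_nonneg q) hq
  have g2 := g.mul_of_nonneg g (fun _ => by positivity) (fun _ => by positivity)
  refine Summable.of_norm_bounded
    ((g.mul_of_nonneg g2 (fun _ => by positivity) (fun _ => by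
      simp only [Pi.zero_apply]; positivity)).mul_right K)
    fun n => (term_le hq (hK n) (he n)).trans ?_
  rw [pow_add, pow_add, mul_assoc (‖q‖^n.1)]

theorem swap12 {f : ℕ → ℕ → ℕ → ℂ} (h : Summable fun n : ℕ × ℕ × ℕ => f n.1 n.2.1 n.2.2) :
    ∑' a, ∑' b, ∑' c, f a b c = ∑' b, ∑' a, ∑' c, f a b c := by
  have h1 : Summable fun n : (ℕ × ℕ) × ℕ => f n.1.1 n.1.2 n.2 :=
    ((Equiv.prodAssoc ℕ ℕ ℕ).summable_iff (f := fun n : ℕ × ℕ × ℕ => f n.1 n.2.1 n.2.2)).mpr h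
  have h2 : Summable (Function.uncurry fun a b => ∑' c, f a b c) := h1.prod
  exact h2.tsum_comm.symm

theorem swap23 {f : ℕ → ℕ → ℕ → ℂ} (h : Summable fun n : ℕ × ℕ × ℕ => f n.1 n.2.1 n.2.2) :
    ∑' a, ∑' b, ∑' c, f a b c = ∑' a, ∑' c, ∑' b, f a b c := by
  refine tsum_congr fun a => ?_
  have h2 : Summable (Function.uncurry fun b c => f a b c) := h.prod_factor a
  exact h2.tsum_comm.symm

theorem tsum3 {f : ℕ → ℕ → ℕ → ℂ} (h : Summable fun n : ℕ × ℕ × ℕ => f n.1 n.2.1 n.2.2) :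
    ∑' n : ℕ × ℕ × ℕ, f n.1 n.2.1 n.2.2 = ∑' a, ∑' b, ∑' c, f a b c := by
  rw [h.tsum_prod]
  refine tsum_congr fun a => ?_
  exact (h.prod_factor a).tsum_prod

theorem tsum_anti {f : ℕ → ℕ → ℂ} (h : Summable fun n : ℕ × ℕ => f n.1 n.2) :
    ∑' a, ∑' b, f a b = ∑' N, ∑ p ∈ Finset.HasAntidiagonal.antidiagonal N, f p.1 p.2 := by
  rw [← h.tsum_prod]
  rw [← Finset.HasAntidiagonal.sigmaAntidiagonalEquivProd.tsum_eq (fun n : ℕ × ℕ => f n.1 n.2)]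
  have h' := Finset.HasAntidiagonal.sigmaAntidiagonalEquivProd.summable_iff.mpr h
  refine (Summable.tsum_sigma' (fun n => (hasSum_fintype _).summable) h').trans ?_
  refine tsum_congr fun N => ?_
  rw [tsum_fintype]
  exact Finset.sum_coe_sort (Finset.HasAntidiagonal.antidiagonal N) (fun p => f p.1 p.2)

theorem summable_anti {f : ℕ → ℕ → ℂ} (h : Summable fun n : ℕ × ℕ => f n.1 n.2) :
    Summable fun N => ∑ p ∈ Finset.HasAntidiagonal.antidiagonal N, f p.1 p.2 := by
  have h' := Finset.HasAntidiagonal.sigmaAntidiagonalEquivProd.summable_iff.mpr h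
  have h2 := h'.sigma' (fun n => (hasSum_fintype _).summable)
  refine h2.congr fun N => ?_
  rw [tsum_fintype]
  exact Finset.sum_coe_sort (Finset.HasAntidiagonal.antidiagonal N) (fun p => f p.1 p.2)

theorem lim_lemma {q : ℂ} (hq : ‖q‖ < 1) {c : ℕ × ℕ → ℂ} (hc : Bd c) {e : ℕ → ℕ → ℕ}
    (he : ∀ s n, s + n ≤ e s (n+1)) (he0 : ∀ s, e s 0 = 0) {L : ℂ}
    (hL : Filter.Tendsto (fun s => c (s, 0)) Filter.atTop (nhds L)) :
    Filter.Tendsto (fun s => ∑' n, q^(e s n) * c (s, n)) Filter.atTop (nhds L) := by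
  obtain ⟨K, hK⟩ := hc
  have g := summable_geometric_of_lt_one (norm_nonneg q) hq
  have hb : ∀ s n, ‖q^(e s (n+1)) * c (s, n+1)‖ ≤ ‖q‖^n * (‖q‖^s * K) := fun s n => by
    refine (term_le hq (hK (s,n+1)) (he s n)).trans (le_of_eq ?_)
    ring
  have hs : ∀ s, Summable fun n => q^(e s n) * c (s, n) := fun s => by
    rw [← summable_nat_add_iff 1]
    exact Summable.of_norm_bounded (g.mul_right (‖q‖^s * K)) (hb s)
  have h1 : Filter.Tendsto (fun s => ∑' n, q^(e s (n+1)) * c (s, n+1)) Filter.atTop (nhds 0) := by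
    refine squeeze_zero_norm (a := fun s => (∑' n, ‖q‖^n) * (‖q‖^s * K)) (fun s => ?_) ?_
    · exact tsum_of_norm_bounded (g.hasSum.mul_right _) (hb s)
    · have := (((tendsto_pow_atTop_nhds_zero_of_lt_one (norm_nonneg q) hq).mul_const K).const_mul
        (∑' n, ‖q‖^n))
      simpa using this
  have h2 := hL.add h1
  rw [add_zero] at h2
  refine h2.congr fun s => ?_
  rw [(hs s).tsum_eq_zero_add, he0, pow_zero, one_mul]

/-- triangular numbers -/
def tri : ℕ → ℕ
  | 0 => 0
  | n+1 => tri n + (n+1)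

theorem le_tri (n : ℕ) : n ≤ tri n := by
  cases n with
  | zero => simp
  | succ n => simp [tri]

/-- Gaussian binomial -/
noncomputable def gb (q : ℂ) (n k : ℕ) : ℂ :=
  if k ≤ n then qPoch q n * ((qPoch q k)⁻¹ * (qPoch q (n-k))⁻¹) else 0

theorem gb_zero {q : ℂ} (hq : ‖q‖ < 1) (n : ℕ) : gb q n 0 = 1 := by
  simp [gb, qPoch_zero, qPoch_ne hq]

theorem gb_of_lt {q : ℂ} {n k : ℕ} (h : n < k) : gb q n k = 0 := by
  simp [gb, h]

theorem gb_self {q : ℂ} (hq : ‖q‖ < 1) (n : ℕ) : gb q n n = 1 := by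
  simp [gb, qPoch_zero, qPoch_ne hq]

theorem gb_add {q : ℂ} (d k : ℕ) :
    gb q (k+d) k = qPoch q (k+d) * ((qPoch q k)⁻¹ * (qPoch q d)⁻¹) := by
  simp [gb]

theorem gb_pascal1 {q : ℂ} (hq : ‖q‖ < 1) (n k : ℕ) :
    gb q (n+1) (k+1) = gb q n (k+1) + q^(n-k) * gb q n k := by
  rcases lt_trichotomy n k with h | rfl | h
  · simp [gb_of_lt h, gb_of_lt (show n < k+1 by omega), gb_of_lt (show n+1 < k+1 by omega)]
  · simp [gb_self hq, gb_of_lt (show n < n+1 by omega)]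
  · obtain ⟨d, rfl⟩ := Nat.exists_eq_add_of_lt h
    have e1 : k + d + 1 + 1 = (k+1) + (d+1) := by omega
    have e2 : k + d + 1 = (k+1) + d := by omega
    have e3 : k + d + 1 = k + (d+1) := by omega
    rw [e1, gb_add]
    nth_rw 1 [e2]
    rw [gb_add, e3, gb_add, Nat.add_sub_cancel_left]
    rw [show k + 1 + (d+1) = (k+d+1)+1 by omega, show k + 1 + d = k+d+1 by omega,
      show k + (d+1) = k+d+1 by omega, qPoch_succ, qPoch_succ q k, qPoch_succ q d]
    have h1 := one_sub_ne hq k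
    have h2 := one_sub_ne hq d
    have h3 := qPoch_ne hq k
    have h4 := qPoch_ne hq d
    field_simp
    ring

theorem gb_pascal2 {q : ℂ} (hq : ‖q‖ < 1) (n k : ℕ) :
    gb q (n+1) (k+1) = q^(k+1) * gb q n (k+1) + gb q n k := by
  rcases lt_trichotomy n k with h | rfl | h
  · simp [gb_of_lt h, gb_of_lt (show n < k+1 by omega), gb_of_lt (show n+1 < k+1 by omega)]
  · simp [gb_self hq, gb_of_lt (show n < n+1 by omega)]
  · obtain ⟨d, rfl⟩ := Nat.exists_eq_add_of_lt h
    have e1 : k + d + 1 + 1 = (k+1) + (d+1) := by omega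
    have e2 : k + d + 1 = (k+1) + d := by omega
    have e3 : k + d + 1 = k + (d+1) := by omega
    rw [e1, gb_add]
    nth_rw 1 [e2]
    rw [gb_add, e3, gb_add]
    rw [show k + 1 + (d+1) = (k+d+1)+1 by omega, show k + 1 + d = k+d+1 by omega,
      show k + (d+1) = k+d+1 by omega, qPoch_succ, qPoch_succ q k, qPoch_succ q d]
    have h1 := one_sub_ne hq k
    have h2 := one_sub_ne hq d
    have h3 := qPoch_ne hq k
    have h4 := qPoch_ne hq d
    field_simp
    ring

theorem Bd.gb {ι : Type} {q : ℂ} (hq : ‖q‖ < 1) (f g : ι → ℕ) : Bd (fun i => gb q (f i) (g i)) := by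
  obtain ⟨K, hK⟩ := (Bd.P hq f).mul ((Bd.I hq g).mul (Bd.I hq fun i => f i - g i))
  refine ⟨K, fun i => ?_⟩
  unfold _root_.gb
  dsimp only
  split_ifs
  · exact hK i
  · rw [norm_zero]; exact (norm_nonneg _).trans (hK i)

theorem gb_sum {q : ℂ} (hq : ‖q‖ < 1) (φ : ℕ → ℂ) (n : ℕ) :
    ∑ j ∈ Finset.range (n+2), φ j * gb q (n+1) j =
      ∑ j ∈ Finset.range (n+1), φ j * gb q n j
      + ∑ j ∈ Finset.range (n+1), φ (j+1) * q^(n-j) * gb q n j := by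
  have h : ∑ j ∈ Finset.range (n+1), φ j * gb q n j = ∑ j ∈ Finset.range (n+2), φ j * gb q n j := by
    rw [Finset.sum_range_succ _ (n+1), gb_of_lt (show n < n+1 by omega)]; simp
  rw [h, Finset.sum_range_succ' _ (n+1), Finset.sum_range_succ' _ (n+1), gb_zero hq, gb_zero hq,
    add_right_comm, ← Finset.sum_add_distrib]
  congr 1
  refine Finset.sum_congr rfl fun j _ => ?_
  rw [gb_pascal1 hq]; ring

theorem vand {q : ℂ} (hq : ‖q‖ < 1) (n : ℕ) : ∀ s,
    ∑ j ∈ Finset.range (n+1), (q^(j*j+s*j) * (qPoch q (j+s))⁻¹) * gb q n j = (qPoch q (n+s))⁻¹ := by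
  induction n with
  | zero => intro s; simp [gb_zero hq]
  | succ n ih =>
    intro s
    rw [gb_sum hq, ih s]
    have : ∑ j ∈ Finset.range (n+1), q^((j+1)*(j+1)+s*(j+1)) * (qPoch q (j+1+s))⁻¹ * q^(n-j) * gb q n j
        = q^(n+s+1) * ∑ j ∈ Finset.range (n+1), (q^(j*j+(s+1)*j) * (qPoch q (j+(s+1)))⁻¹) * gb q n j := by
      rw [Finset.mul_sum]
      refine Finset.sum_congr rfl fun j hj => ?_
      have hj : j ≤ n := by simpa [Nat.lt_succ_iff] using hj
      obtain ⟨d, rfl⟩ := Nat.exists_eq_add_of_le hj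
      rw [Nat.add_sub_cancel_left, show j + 1 + s = j + (s+1) by ring]
      ring
    rw [this, ih (s+1), show n + (s+1) = (n+s)+1 by ring, show n + 1 + s = (n+s)+1 by ring, qPoch_succ]
    have h1 := one_sub_ne hq (n+s)
    have h3 := qPoch_ne hq (n+s)
    field_simp
    ring

/-- Euler 1 -/
theorem euler1 {q : ℂ} (hq : ‖q‖ < 1) (m : ℕ) :
    ∑' n, q^((m+1)*n) * (qPoch q n)⁻¹ = qPoch q m * (qPochInf q)⁻¹ := by
  set E : ℕ → ℂ := fun m => ∑' n, q^((m+1)*n) * (qPoch q n)⁻¹ with hE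
  have hs : ∀ m, Summable fun n => q^((m+1)*n) * (qPoch q n)⁻¹ := fun m =>
    summ1 hq (Bd.I hq fun n => n) (e := fun n => (m+1)*n) (fun n => by nlinarith)
  have hr : ∀ m, E (m+1) = (1 - q^(m+1)) * E m := by
    intro m
    have h1 : E m - E (m+1) = q^(m+1) * E m := by
      simp only [hE]
      rw [← (hs m).tsum_sub (hs (m+1)), ((hs m).sub (hs (m+1))).tsum_eq_zero_add, ← tsum_mul_left]
      simp only [mul_zero, pow_zero, sub_self, zero_add]
      refine tsum_congr fun n => ?_
      rw [qPoch_succ]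
      have h1 := one_sub_ne hq n
      have h3 := qPoch_ne hq n
      field_simp
      ring
    linear_combination -h1
  have hm : ∀ m, E m = qPoch q m * E 0 := by
    intro m
    induction m with
    | zero => simp [qPoch_zero]
    | succ m ih => rw [hr, ih, qPoch_succ]; ring
  have hl : Filter.Tendsto E Filter.atTop (nhds 1) := by
    refine lim_lemma hq (c := fun p => (qPoch q p.2)⁻¹) (Bd.I hq _) (e := fun m n => (m+1)*n)
      (fun s n => by nlinarith) (fun s => by simp) ?_
    simp [qPoch_zero]
  have h2 : Filter.Tendsto E Filter.atTop (nhds (qPochInf q * E 0)) :=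
    ((qPoch_tendsto hq).mul_const _).congr fun m => (hm m).symm
  have h3 := tendsto_nhds_unique h2 hl
  change E m = _
  rw [hm, eq_inv_of_mul_eq_one_right h3]

/-- Euler 2 -/
theorem euler2 {q : ℂ} (hq : ‖q‖ < 1) (n : ℕ) :
    ∑' k, q^(tri k + k*n) * ((-1)^k * (qPoch q k)⁻¹) = qPochInf q * (qPoch q n)⁻¹ := by
  set E : ℕ → ℂ := fun n => ∑' k, q^(tri k + k*n) * ((-1)^k * (qPoch q k)⁻¹) with hE
  have hs : ∀ n, Summable fun k => q^(tri k + k*n) * ((-1)^k * (qPoch q k)⁻¹) := fun m =>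
    summ1 hq ((Bd.sign _).mul (Bd.I hq fun n => n)) (e := fun k => tri k + k*m)
      (fun n => by have := le_tri n; nlinarith)
  have hr : ∀ n, E n = (1 - q^(n+1)) * E (n+1) := by
    intro m
    have h1 : E m - E (m+1) = -q^(m+1) * E (m+1) := by
      simp only [hE]
      rw [← (hs m).tsum_sub (hs (m+1)), ((hs m).sub (hs (m+1))).tsum_eq_zero_add, ← tsum_mul_left]
      simp only [zero_mul, sub_self, zero_add]
      refine tsum_congr fun n => ?_
      rw [qPoch_succ, tri]
      have h1 := one_sub_ne hq n
      have h3 := qPoch_ne hq n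
      field_simp
      ring
    linear_combination h1
  have hm : ∀ m, qPoch q m * E m = E 0 := by
    intro m
    induction m with
    | zero => simp [qPoch_zero]
    | succ m ih => rw [← ih, hr m, qPoch_succ]; ring
  have hl : Filter.Tendsto E Filter.atTop (nhds 1) := by
    refine lim_lemma hq (c := fun p => (-1)^p.2 * (qPoch q p.2)⁻¹) ((Bd.sign _).mul (Bd.I hq _))
      (e := fun m k => tri k + k*m)
      (fun s n => by have := le_tri (n+1); nlinarith) (fun s => by simp [tri]) ?_
    simp [qPoch_zero]
  have h2 : Filter.Tendsto (fun m => qPoch q m * E m) Filter.atTop (nhds (qPochInf q * 1)) :=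
    (qPoch_tendsto hq).mul hl
  have h4 : Filter.Tendsto (fun m => qPoch q m * E m) Filter.atTop (nhds (E 0)) := by
    simp only [hm]; exact tendsto_const_nhds
  have h3 := tendsto_nhds_unique h2 h4
  change E n = _
  rw [← mul_one (qPochInf q), h3, ← hm n]
  have := qPoch_ne hq n
  field_simp

/-- the sums `A(m)` -/
noncomputable def AA (q : ℂ) (m : ℕ) : ℂ := ∑' n, q^(n*(m+1)) * ((qPoch q n)⁻¹ * (qPoch q n)⁻¹)

theorem AA_a {q : ℂ} (hq : ‖q‖ < 1) (m : ℕ) : qPochInf q ^ 2 * AA q m =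
    ∑' k, q^(tri k) * ((-1)^k * (qPoch q (m+k) * (qPoch q k)⁻¹)) := by
  have hne := qPochInf_ne hq
  have hsum : Summable (Function.uncurry fun n k : ℕ =>
      q^(n*(m+1) + tri k + k*n) * ((-1)^k * ((qPoch q k)⁻¹ * (qPoch q n)⁻¹))) := by
    refine summ2 hq (c := fun p => (-1)^p.2 * ((qPoch q p.2)⁻¹ * (qPoch q p.1)⁻¹))
      (e := fun p => p.1*(m+1) + tri p.2 + p.2*p.1)
      ((Bd.sign _).mul ((Bd.I hq _).mul (Bd.I hq _))) ?_
    intro n; have := le_tri n.2; nlinarith [Nat.zero_le (n.1*m), Nat.zero_le (n.2*n.1)]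
  have h1 : qPochInf q * AA q m = ∑' n, ∑' k,
      q^(n*(m+1) + tri k + k*n) * ((-1)^k * ((qPoch q k)⁻¹ * (qPoch q n)⁻¹)) := by
    rw [AA, ← tsum_mul_left]
    refine tsum_congr fun n => ?_
    have := euler2 hq n
    calc _ = q^(n*(m+1)) * (qPoch q n)⁻¹ * (qPochInf q * (qPoch q n)⁻¹) := by ring
      _ = _ := by
        rw [← this, ← tsum_mul_left]
        refine tsum_congr fun k => ?_
        ring
  rw [pow_two, mul_assoc, h1, hsum.tsum_comm.symm, ← tsum_mul_left]
  refine tsum_congr fun k => ?_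
  have := euler1 hq (m+k)
  calc _ = qPochInf q * (q^(tri k) * ((-1)^k * (qPoch q k)⁻¹) *
        ∑' n, q^((m+k+1)*n) * (qPoch q n)⁻¹) := by
        rw [← tsum_mul_left (a := q^(tri k) * ((-1)^k * (qPoch q k)⁻¹))]
        congr 1
        refine tsum_congr fun n => ?_
        ring
    _ = _ := by rw [this]; field_simp

theorem AA_b {q : ℂ} (hq : ‖q‖ < 1) (m : ℕ) : qPochInf q * AA q m =
    qPoch q m * ∑' n, q^(n*n+n*(m+1)) * ((qPoch q n)⁻¹ * (qPoch q n)⁻¹) := by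
  have hne := qPochInf_ne hq
  have hsum : Summable (fun p : ℕ × ℕ =>
      q^((p.1+p.2)*(m+1) + p.1*p.1) * ((qPoch q p.1)⁻¹ * ((qPoch q p.1)⁻¹ * (qPoch q p.2)⁻¹))) := by
    refine summ2 hq (c := fun p => ((qPoch q p.1)⁻¹ * ((qPoch q p.1)⁻¹ * (qPoch q p.2)⁻¹)))
      (e := fun p => (p.1+p.2)*(m+1) + p.1*p.1)
      ((Bd.I hq _).mul ((Bd.I hq _).mul (Bd.I hq _))) ?_
    intro n; nlinarith [Nat.zero_le (n.1*m), Nat.zero_le (n.2*m), Nat.zero_le (n.1*n.1)]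
  have h1 : AA q m = ∑' j, ∑' l,
      q^((j+l)*(m+1) + j*j) * ((qPoch q j)⁻¹ * ((qPoch q j)⁻¹ * (qPoch q l)⁻¹)) := by
    rw [tsum_anti (f := fun j l => q^((j+l)*(m+1) + j*j) *
      ((qPoch q j)⁻¹ * ((qPoch q j)⁻¹ * (qPoch q l)⁻¹))) hsum, AA]
    refine tsum_congr fun n => ?_
    have := vand hq n 0
    rw [add_zero] at this
    nth_rw 1 [← this]
    rw [Finset.Nat.sum_antidiagonal_eq_sum_range_succ_mk, Finset.sum_mul, Finset.mul_sum]
    refine Finset.sum_congr rfl fun j hj => ?_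
    have hj : j ≤ n := by simpa [Nat.lt_succ_iff] using hj
    obtain ⟨d, rfl⟩ := Nat.exists_eq_add_of_le hj
    rw [gb_add, Nat.add_sub_cancel_left, add_zero]
    have h3 := qPoch_ne hq (j+d)
    field_simp
    ring
  rw [h1, ← tsum_mul_left, ← tsum_mul_left]
  refine tsum_congr fun j => ?_
  have := euler1 hq m
  calc _ = qPochInf q * (q^(j*j+j*(m+1)) * ((qPoch q j)⁻¹ * (qPoch q j)⁻¹) *
        ∑' n, q^((m+1)*n) * (qPoch q n)⁻¹) := by
        rw [← tsum_mul_left (a := q^(j*j+j*(m+1)) * ((qPoch q j)⁻¹ * (qPoch q j)⁻¹))]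
        congr 1
        refine tsum_congr fun n => ?_
        ring
    _ = _ := by rw [this]; field_simp

theorem MM {q : ℂ} (hq : ‖q‖ < 1) (k : ℕ) : ∀ n,
    ∑' m, q^(m*(n+1)) * (qPoch q (m+k) * (qPoch q m)⁻¹)
      = qPoch q k * (qPoch q n * (qPoch q (n+k+1))⁻¹) := by
  have hs : ∀ k n, Summable fun m => q^(m*(n+1)) * (qPoch q (m+k) * (qPoch q m)⁻¹) := fun k n =>
    summ1 hq ((Bd.P hq _).mul (Bd.I hq fun m => m)) (e := fun m => m*(n+1)) (fun m => by nlinarith)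
  induction k with
  | zero =>
    intro n
    have h1 : ∀ m, q^(m*(n+1)) * (qPoch q (m+0) * (qPoch q m)⁻¹) = (q^(n+1))^m := fun m => by
      rw [add_zero, mul_inv_cancel₀ (qPoch_ne hq m), mul_one, mul_comm m, pow_mul]
    simp only [h1]
    rw [tsum_geometric_of_norm_lt_one, qPoch_zero, add_zero, qPoch_succ]
    · have := qPoch_ne hq n
      have := one_sub_ne hq n
      field_simp
    · rw [norm_pow]; exact pow_lt_one₀ (norm_nonneg _) hq (by omega)
  | succ k ih =>
    intro n
    have h1 : ∑' m, q^(m*(n+1)) * (qPoch q (m+(k+1)) * (qPoch q m)⁻¹)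
        = ∑' m, q^(m*(n+1)) * (qPoch q (m+k) * (qPoch q m)⁻¹)
          - q^(k+1) * ∑' m, q^(m*(n+1+1)) * (qPoch q (m+k) * (qPoch q m)⁻¹) := by
      rw [← tsum_mul_left, ← (hs k n).tsum_sub ((hs k (n+1)).mul_left _)]
      refine tsum_congr fun m => ?_
      rw [← add_assoc m k 1, qPoch_succ]
      ring
    rw [h1, ih n, ih (n+1), qPoch_succ q k, show n + 1 + k + 1 = (n+k+1)+1 by ring,
      show n + (k+1) + 1 = (n+k+1)+1 by ring, qPoch_succ q n, qPoch_succ q (n+k+1)]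
    have := qPoch_ne hq (n+k+1)
    have := one_sub_ne hq (n+k+1)
    field_simp
    ring

noncomputable def WW (q : ℂ) (s r : ℕ) : ℂ :=
  ∑' n, q^(n*n+r*n) * ((qPoch q n)⁻¹ * (qPoch q (n+s))⁻¹)

theorem WW_summable {q : ℂ} (hq : ‖q‖ < 1) (s r : ℕ) :
    Summable fun n => q^(n*n+r*n) * ((qPoch q n)⁻¹ * (qPoch q (n+s))⁻¹) :=
  summ1 hq ((Bd.I hq fun n => n).mul (Bd.I hq _)) (e := fun n => n*n+r*n) fun n => by
    have := Nat.le_mul_self n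
    nlinarith [Nat.zero_le (r*n)]

theorem WW_rec1 {q : ℂ} (hq : ‖q‖ < 1) (s r : ℕ) :
    WW q s r = WW q (s+1) r - q^(s+1) * WW q (s+1) (r+1) := by
  simp only [WW]
  rw [← tsum_mul_left, ← (WW_summable hq _ _).tsum_sub ((WW_summable hq _ _).mul_left _)]
  refine tsum_congr fun n => ?_
  rw [← add_assoc n s 1, qPoch_succ]
  have := qPoch_ne hq (n+s)
  have := one_sub_ne hq (n+s)
  field_simp
  ring

theorem WW_rec2 {q : ℂ} (hq : ‖q‖ < 1) (s r : ℕ) :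
    WW q s r - WW q s (r+1) = q^(r+1) * WW q (s+1) (r+2) := by
  simp only [WW]
  rw [← (WW_summable hq _ _).tsum_sub (WW_summable hq _ _),
    ((WW_summable hq _ _).sub (WW_summable hq _ _)).tsum_eq_zero_add, ← tsum_mul_left]
  simp only [mul_zero, add_zero, sub_self, zero_add]
  refine tsum_congr fun n => ?_
  rw [show n + 1 + s = n + (s+1) by ring, qPoch_succ]
  have := qPoch_ne hq n
  have := one_sub_ne hq n
  field_simp
  ring

theorem WW_diag {q : ℂ} (hq : ‖q‖ < 1) (s : ℕ) : WW q s s = (qPochInf q)⁻¹ := by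
  have h1 : ∀ s, WW q s s = WW q (s+1) (s+1) := fun s => by
    linear_combination WW_rec2 hq s s + WW_rec1 hq s (s+1)
  have h2 : ∀ s, WW q s s = WW q 0 0 := fun s => by
    induction s with
    | zero => rfl
    | succ s ih => rw [← h1, ih]
  have h3 : Filter.Tendsto (fun s => WW q s s) Filter.atTop (nhds (qPochInf q)⁻¹) := by
    refine lim_lemma hq (c := fun p => (qPoch q p.2)⁻¹ * (qPoch q (p.2+p.1))⁻¹)
      ((Bd.I hq _).mul (Bd.I hq _)) (e := fun s n => n*n+s*n)
      (fun s n => by nlinarith [Nat.zero_le (s*n), Nat.zero_le (n*n)]) (fun s => by simp) ?_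
    simpa [qPoch_zero] using (qPoch_tendsto hq).inv₀ (qPochInf_ne hq)
  have h4 : Filter.Tendsto (fun s => WW q s s) Filter.atTop (nhds (WW q 0 0)) := by
    simp only [h2]; exact tendsto_const_nhds
  rw [h2, tendsto_nhds_unique h4 h3]

theorem WW_gb {q : ℂ} (hq : ‖q‖ < 1) (k : ℕ) : ∀ r,
    qPochInf q * WW q (r+k) r = ∑ i ∈ Finset.range (k+1), q^(i*i+r*i) * gb q k i := by
  induction k with
  | zero =>
    intro r
    rw [add_zero, WW_diag hq, mul_inv_cancel₀ (qPochInf_ne hq)]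
    simp [gb_zero hq]
  | succ k ih =>
    intro r
    rw [gb_sum hq, ← ih r]
    have : ∑ j ∈ Finset.range (k+1), q^((j+1)*(j+1)+r*(j+1)) * q^(k-j) * gb q k j
        = q^(r+k+1) * ∑ j ∈ Finset.range (k+1), q^(j*j+(r+1)*j) * gb q k j := by
      rw [Finset.mul_sum]
      refine Finset.sum_congr rfl fun j hj => ?_
      have hj : j ≤ k := by simpa [Nat.lt_succ_iff] using hj
      obtain ⟨d, rfl⟩ := Nat.exists_eq_add_of_le hj
      rw [Nat.add_sub_cancel_left]
      ring
    rw [this, ← ih (r+1)]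
    have h := WW_rec1 hq (r+k) r
    rw [show r + (k+1) = r+k+1 by ring, show r + 1 + k = r+k+1 by ring, h]
    ring

noncomputable def uu (q : ℂ) (N : ℕ) : ℂ :=
  ∑ p ∈ Finset.HasAntidiagonal.antidiagonal N, (-1)^p.2 * q^(tri p.1 + p.2*p.2 + p.2) * gb q p.1 p.2

noncomputable def vv (q : ℂ) (N : ℕ) : ℂ :=
  ∑ p ∈ Finset.HasAntidiagonal.antidiagonal N, (-1)^p.2 * q^(tri p.1 + p.2*p.2) * gb q p.1 p.2

theorem uu_rec {q : ℂ} (hq : ‖q‖ < 1) (N : ℕ) :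
    uu q (N+2) = q^(N+2) * vv q (N+1) - q^(2*N+3) * vv q N := by
  rw [uu, Finset.Nat.sum_antidiagonal_succ, gb_of_lt (by simp), mul_zero, zero_add,
    Finset.Nat.sum_antidiagonal_succ', vv, Finset.Nat.sum_antidiagonal_succ', vv, mul_add,
    Finset.mul_sum, Finset.mul_sum, add_sub_assoc, ← Finset.sum_sub_distrib]
  congr 1
  · simp only [gb_zero hq, tri]; ring
  · refine Finset.sum_congr rfl fun p hp => ?_
    obtain ⟨k, l⟩ := p
    have hp : k + l = N := by simpa using hp
    subst hp
    dsimp only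
    rw [gb_pascal1 hq, tri]
    rcases le_or_gt l k with h | h
    · obtain ⟨d, rfl⟩ := Nat.exists_eq_add_of_le h
      rw [Nat.add_sub_cancel_left]
      ring
    · rw [gb_of_lt h, gb_of_lt (show k < l + 1 by omega)]; simp

theorem vv_rec {q : ℂ} (hq : ‖q‖ < 1) (N : ℕ) :
    vv q (N+2) = q^(N+2) * vv q (N+1) - q^(N+2) * uu q N := by
  rw [vv, Finset.Nat.sum_antidiagonal_succ, gb_of_lt (by simp), mul_zero, zero_add,
    Finset.Nat.sum_antidiagonal_succ', vv, Finset.Nat.sum_antidiagonal_succ', uu, mul_add,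
    Finset.mul_sum, Finset.mul_sum, add_sub_assoc, ← Finset.sum_sub_distrib]
  congr 1
  · simp only [gb_zero hq, tri]; ring
  · refine Finset.sum_congr rfl fun p hp => ?_
    obtain ⟨k, l⟩ := p
    have hp : k + l = N := by simpa using hp
    subst hp
    dsimp only
    rw [gb_pascal2 hq, tri]
    ring

theorem uu_rec3 {q : ℂ} (hq : ‖q‖ < 1) (N : ℕ) : uu q (N+3) = -q^(2*N+5) * uu q N := by
  rw [show N + 3 = (N+1)+2 by ring, uu_rec hq, show N + 1 + 1 = N + 2 by ring, vv_rec hq]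
  ring

theorem uu_zero {q : ℂ} (hq : ‖q‖ < 1) : uu q 0 = 1 := by
  simp [uu, tri, gb_zero hq]

theorem uu_one {q : ℂ} (hq : ‖q‖ < 1) : uu q 1 = q := by
  simp [uu, Finset.Nat.sum_antidiagonal_succ, tri, gb_zero hq, gb_of_lt]

theorem uu_two {q : ℂ} (hq : ‖q‖ < 1) : uu q 2 = 0 := by
  rw [show 2 = 0 + 2 by rfl, uu_rec hq]
  simp [vv, Finset.Nat.sum_antidiagonal_succ, tri, gb_zero hq, gb_of_lt]
  ring

theorem cc0 {q : ℂ} (hq : ‖q‖ < 1) (m : ℕ) : (-1)^(3*m) * uu q (3*m) = q^(3*m*m+2*m) := by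
  induction m with
  | zero => simp [uu_zero hq]
  | succ m ih =>
    rw [show 3*(m+1) = 3*m+3 by ring, uu_rec3 hq]
    calc _ = q^(2*(3*m)+5) * ((-1)^(3*m) * uu q (3*m)) := by ring
      _ = _ := by rw [ih]; ring

theorem cc1 {q : ℂ} (hq : ‖q‖ < 1) (m : ℕ) :
    (-1)^(1+3*m) * uu q (1+3*m) = -q^(3*m*m+4*m+1) := by
  induction m with
  | zero => simp [uu_one hq]
  | succ m ih =>
    rw [show 1+3*(m+1) = 1+3*m+3 by ring, uu_rec3 hq]
    calc _ = q^(2*(1+3*m)+5) * ((-1)^(1+3*m) * uu q (1+3*m)) := by ring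
      _ = _ := by rw [ih]; ring

theorem cc2 {q : ℂ} (hq : ‖q‖ < 1) (m : ℕ) : uu q (2+3*m) = 0 := by
  induction m with
  | zero => simp [uu_two hq]
  | succ m ih => rw [show 2+3*(m+1) = 2+3*m+3 by ring, uu_rec3 hq, ih, mul_zero]

theorem final_sum {q : ℂ} (hq : ‖q‖ < 1) :
    ∑' k, q^(tri k) * ((-1)^k * ∑ i ∈ Finset.range (k+1), q^(i*i+1*i) * gb q k i)
    = ∑' n : ℤ, (if 0 ≤ n then (1 : ℂ) else -1) * q ^ (3 * n ^ 2 + 2 * n).toNat := by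
  have hsum : Summable (fun p : ℕ × ℕ =>
      q^(tri p.1 + p.2*p.2+p.2) * ((-1)^p.1 * gb q p.1 p.2)) := by
    refine summ2 hq (c := fun p => (-1)^p.1 * gb q p.1 p.2)
      (e := fun p => tri p.1 + p.2*p.2+p.2) ((Bd.sign _).mul (Bd.gb hq _ _)) ?_
    intro n; have := le_tri n.1; nlinarith [Nat.zero_le (n.2*n.2)]
  have hN : ∀ N, ∑ p ∈ Finset.HasAntidiagonal.antidiagonal N,
      q^(tri p.1 + p.2*p.2+p.2) * ((-1)^p.1 * gb q p.1 p.2) = (-1)^N * uu q N := fun N => by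
    rw [uu, Finset.mul_sum]
    refine Finset.sum_congr rfl fun p hp => ?_
    have hp : p.1 + p.2 = N := by simpa using hp
    rw [← hp, pow_add]
    have : (-1 : ℂ)^p.2 * (-1)^p.2 = 1 := by rw [← mul_pow]; simp
    linear_combination (-(-1)^p.1 * q ^ (tri p.1 + p.2 * p.2 + p.2) * gb q p.1 p.2) * this
  have h1 : ∑' k, q^(tri k) * ((-1)^k * ∑ i ∈ Finset.range (k+1), q^(i*i+1*i) * gb q k i)
      = ∑' k, ∑' i, q^(tri k + i*i+i) * ((-1)^k * gb q k i) := by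
    refine tsum_congr fun k => ?_
    rw [tsum_eq_sum (s := Finset.range (k+1)), Finset.mul_sum, Finset.mul_sum]
    · refine Finset.sum_congr rfl fun i _ => ?_
      ring
    · intro i hi
      rw [gb_of_lt (by simpa using hi)]; simp
  have hsN := summable_anti (f := fun k i => q^(tri k + i*i+i) * ((-1)^k * gb q k i)) hsum
  simp only [hN] at hsN
  rw [h1, tsum_anti (f := fun k i => q^(tri k + i*i+i) * ((-1)^k * gb q k i)) hsum]
  simp only [hN]
  rw [Nat.sumByResidueClasses hsN 3]
  have e1 : ∀ n : ℕ, (if (0:ℤ) ≤ (n:ℤ) then (1 : ℂ) else -1) * q ^ (3 * (n:ℤ) ^ 2 + 2 * n).toNat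
      = q^(3*n*n+2*n) * 1 := fun n => by
    rw [if_pos (by positivity), one_mul, mul_one]
    congr 1
    have : (3 * (n:ℤ) ^ 2 + 2 * n) = ((3*n*n+2*n : ℕ) : ℤ) := by push_cast; ring
    rw [this, Int.toNat_natCast]
  have e2 : ∀ n : ℕ, (if (0:ℤ) ≤ -((n:ℤ)+1) then (1 : ℂ) else -1)
      * q ^ (3 * (-((n:ℤ)+1)) ^ 2 + 2 * (-((n:ℤ)+1))).toNat
      = q^(3*n*n+4*n+1) * (-1) := fun n => by
    rw [if_neg (by omega), neg_one_mul, mul_neg_one]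
    congr 2
    have : (3 * (-((n:ℤ)+1)) ^ 2 + 2 * (-((n:ℤ)+1))) = ((3*n*n+4*n+1 : ℕ) : ℤ) := by
      push_cast; ring
    rw [this, Int.toNat_natCast]
  rw [tsum_of_nat_of_neg_add_one]
  · simp only [e1, e2]
    have : (Finset.univ : Finset (ZMod 3)) = {0, 1, 2} := by decide
    rw [this, Finset.sum_insert (by decide), Finset.sum_insert (by decide), Finset.sum_singleton]
    have z0 : (0 : ZMod 3).val = 0 := rfl
    have z1 : (1 : ZMod 3).val = 1 := rfl
    have z2 : (2 : ZMod 3).val = 2 := rfl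
    simp only [z0, z1, z2, zero_add, cc0 hq, cc1 hq, cc2 hq, mul_zero, tsum_zero, add_zero,
      mul_one, mul_neg]
  · simp only [e1]
    exact summ1 hq (Bd.const 1) (e := fun n => 3*n*n+2*n) fun n => by
      nlinarith [Nat.zero_le (n*n)]
  · simp only [e2]
    exact summ1 hq (Bd.const (-1)) (e := fun n => 3*n*n+4*n+1) fun n => by
      nlinarith [Nat.zero_le (n*n)]

theorem main_sum {q : ℂ} (hq : ‖q‖ < 1) :
    qPochInf q ^ 4 * ∑' m, q^m * ((qPoch q m)⁻¹ * (qPoch q m)⁻¹) * (AA q m * AA q m)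
    = ∑' k, q^(tri k) * ((-1)^k * ∑ i ∈ Finset.range (k+1), q^(i*i+1*i) * gb q k i) := by
  have hsum : Summable (fun p : ℕ × ℕ × ℕ => q^(p.1 + tri p.2.1 + p.2.2*p.2.2+p.2.2*(p.1+1)) *
      ((-1)^p.2.1 * (qPoch q (p.1+p.2.1) * ((qPoch q p.1)⁻¹ * ((qPoch q p.2.1)⁻¹ *
        ((qPoch q p.2.2)⁻¹ * (qPoch q p.2.2)⁻¹)))))) := by
    refine summ3 hq (c := fun p => ((-1)^p.2.1 * (qPoch q (p.1+p.2.1) * ((qPoch q p.1)⁻¹ *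
        ((qPoch q p.2.1)⁻¹ * ((qPoch q p.2.2)⁻¹ * (qPoch q p.2.2)⁻¹))))))
      (e := fun p => p.1 + tri p.2.1 + p.2.2*p.2.2+p.2.2*(p.1+1))
      ((Bd.sign _).mul ((Bd.P hq _).mul ((Bd.I hq _).mul ((Bd.I hq _).mul
        ((Bd.I hq _).mul (Bd.I hq _)))))) ?_
    intro n; have := le_tri n.2.1
    nlinarith [Nat.zero_le (n.2.2*n.2.2), Nat.zero_le (n.2.2*n.1)]
  have h1 : qPochInf q ^ 3 * ∑' m, q^m * ((qPoch q m)⁻¹ * (qPoch q m)⁻¹) * (AA q m * AA q m)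
      = ∑' m, ∑' k, ∑' n, q^(m + tri k + n*n+n*(m+1)) *
      ((-1)^k * (qPoch q (m+k) * ((qPoch q m)⁻¹ * ((qPoch q k)⁻¹ *
        ((qPoch q n)⁻¹ * (qPoch q n)⁻¹))))) := by
    rw [← tsum_mul_left]
    refine tsum_congr fun m => ?_
    calc _ = q^m * ((qPoch q m)⁻¹ * (qPoch q m)⁻¹) * (qPochInf q ^ 2 * AA q m) *
          (qPochInf q * AA q m) := by ring
      _ = q^m * (qPoch q m)⁻¹ *
          (∑' n, q^(n*n+n*(m+1)) * ((qPoch q n)⁻¹ * (qPoch q n)⁻¹)) *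
          ∑' k, q^(tri k) * ((-1)^k * (qPoch q (m+k) * (qPoch q k)⁻¹)) := by
        rw [AA_a hq, AA_b hq]
        have := qPoch_ne hq m
        field_simp
      _ = _ := by
        rw [← tsum_mul_left]
        refine tsum_congr fun k => ?_
        rw [mul_right_comm, ← tsum_mul_left]
        refine tsum_congr fun n => ?_
        ring
  have h2 : ∀ k, ∑' m, ∑' n, q^(m + tri k + n*n+n*(m+1)) *
      ((-1)^k * (qPoch q (m+k) * ((qPoch q m)⁻¹ * ((qPoch q k)⁻¹ *
        ((qPoch q n)⁻¹ * (qPoch q n)⁻¹))))) = q^(tri k) * ((-1)^k * WW q (1+k) 1) := by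
    intro k
    have hs2 : Summable (Function.uncurry fun m n : ℕ => q^(m + tri k + n*n+n*(m+1)) *
      ((-1)^k * (qPoch q (m+k) * ((qPoch q m)⁻¹ * ((qPoch q k)⁻¹ *
        ((qPoch q n)⁻¹ * (qPoch q n)⁻¹)))))) :=
      hsum.comp_injective (i := fun p : ℕ × ℕ => (p.1, k, p.2)) fun a b h => by
        simp only [Prod.mk.injEq] at h
        exact Prod.ext h.1 h.2.2
    rw [hs2.tsum_comm.symm, WW, ← tsum_mul_left, ← tsum_mul_left]
    refine tsum_congr fun n => ?_
    calc _ = q^(tri k + n*n + n) * ((-1)^k * ((qPoch q k)⁻¹ * ((qPoch q n)⁻¹ * (qPoch q n)⁻¹))) *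
          ∑' m, q^(m*(n+1)) * (qPoch q (m+k) * (qPoch q m)⁻¹) := by
          rw [← tsum_mul_left]
          refine tsum_congr fun m => ?_
          ring
      _ = _ := by
        rw [MM hq, show n + (1+k) = n+k+1 by ring]
        have := qPoch_ne hq n
        have := qPoch_ne hq k
        field_simp
        ring
  rw [show (4:ℕ) = 1 + 3 by rfl, pow_add, pow_one, mul_assoc, h1,
    swap12 (f := fun m k n => q^(m + tri k + n*n+n*(m+1)) *
      ((-1)^k * (qPoch q (m+k) * ((qPoch q m)⁻¹ * ((qPoch q k)⁻¹ *
        ((qPoch q n)⁻¹ * (qPoch q n)⁻¹)))))) hsum, ← tsum_mul_left]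
  refine tsum_congr fun k => ?_
  rw [h2, ← WW_gb hq k 1]
  ring

theorem stmt7 (q : ℂ) (hq : ‖q‖ < 1) :
    ∑' n : ℕ × ℕ × ℕ,
        q ^ (n.1 + n.2.1 + n.2.2 + n.1 * n.2.1 + n.2.1 * n.2.2)
          / (qPoch q n.1 ^ 2 * qPoch q n.2.1 ^ 2 * qPoch q n.2.2 ^ 2)
      = (∑' n : ℤ, (if 0 ≤ n then (1 : ℂ) else -1) * q ^ (3 * n ^ 2 + 2 * n).toNat)
          / qPochInf q ^ 4 := by
  have hsum : Summable (fun n : ℕ × ℕ × ℕ =>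
      q ^ (n.1 + n.2.1 + n.2.2 + n.1 * n.2.1 + n.2.1 * n.2.2) *
      ((qPoch q n.1)⁻¹ * ((qPoch q n.1)⁻¹ * ((qPoch q n.2.1)⁻¹ * ((qPoch q n.2.1)⁻¹ *
       ((qPoch q n.2.2)⁻¹ * (qPoch q n.2.2)⁻¹)))))) := by
    refine summ3 hq (e := fun n => n.1 + n.2.1 + n.2.2 + n.1 * n.2.1 + n.2.1 * n.2.2)
      ((Bd.I hq _).mul ((Bd.I hq _).mul ((Bd.I hq _).mul ((Bd.I hq _).mul
        ((Bd.I hq _).mul (Bd.I hq _)))))) ?_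
    intro n; omega
  have h0 : ∑' n : ℕ × ℕ × ℕ,
        q ^ (n.1 + n.2.1 + n.2.2 + n.1 * n.2.1 + n.2.1 * n.2.2)
          / (qPoch q n.1 ^ 2 * qPoch q n.2.1 ^ 2 * qPoch q n.2.2 ^ 2)
      = ∑' m, q^m * ((qPoch q m)⁻¹ * (qPoch q m)⁻¹) * (AA q m * AA q m) := by
    have e : ∀ n : ℕ × ℕ × ℕ, q ^ (n.1 + n.2.1 + n.2.2 + n.1 * n.2.1 + n.2.1 * n.2.2)
          / (qPoch q n.1 ^ 2 * qPoch q n.2.1 ^ 2 * qPoch q n.2.2 ^ 2) =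
      q ^ (n.1 + n.2.1 + n.2.2 + n.1 * n.2.1 + n.2.1 * n.2.2) *
      ((qPoch q n.1)⁻¹ * ((qPoch q n.1)⁻¹ * ((qPoch q n.2.1)⁻¹ * ((qPoch q n.2.1)⁻¹ *
       ((qPoch q n.2.2)⁻¹ * (qPoch q n.2.2)⁻¹))))) := fun n => by
      rw [div_eq_mul_inv]; simp only [mul_inv, pow_two]; ring
    rw [tsum_congr e, tsum3 (f := fun a b c => q ^ (a + b + c + a * b + b * c) *
      ((qPoch q a)⁻¹ * ((qPoch q a)⁻¹ * ((qPoch q b)⁻¹ * ((qPoch q b)⁻¹ *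
       ((qPoch q c)⁻¹ * (qPoch q c)⁻¹)))))) hsum,
      swap12 (f := fun a b c => q ^ (a + b + c + a * b + b * c) *
      ((qPoch q a)⁻¹ * ((qPoch q a)⁻¹ * ((qPoch q b)⁻¹ * ((qPoch q b)⁻¹ *
       ((qPoch q c)⁻¹ * (qPoch q c)⁻¹)))))) hsum]
    refine tsum_congr fun m => ?_
    nth_rw 1 [AA]
    rw [← tsum_mul_right, ← tsum_mul_left]
    refine tsum_congr fun a => ?_
    rw [AA, ← tsum_mul_left, ← tsum_mul_left]
    refine tsum_congr fun c => ?_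
    ring
  rw [h0, eq_div_iff (pow_ne_zero 4 (qPochInf_ne hq)), mul_comm, main_sum hq, final_sum hq]
end

section
/- For |q| < 1 and any integer k ≥ 2, the k-fold sum ∑_{n₁,…,n_k≥0} q^{n₁+⋯+n_k + n₁n₂+n₂n₃+⋯+n_{k-1}n_k} / ((q;q)_{n₁} (q;q)_{n₂}² ⋯ (q;q)_{n_{k-1}}² (q;q)_{n_k}), where the first and last Pochhammer factors appear to the first power and all intermediate ones to the second power, equals 1/((1-q)·(q;q)_∞^{k-1}). -/
open Filter Topology in
lemma aux_mult (q : ℂ) (hq : ‖q‖ < 1) : Tendsto (qPoch q) atTop (𝓝 (qPochInf q)) :=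
  (ModularForm.multipliable_one_sub_pow hq).tendsto_prod_tprod_nat

lemma aux_fac (q : ℂ) (hq : ‖q‖ < 1) (i : ℕ) : 1 - q ^ (i + 1) ≠ 0 := by
  intro h
  have h1 : q ^ (i + 1) = 1 := (sub_eq_zero.mp h).symm
  have h2 : ‖q‖ ^ (i + 1) < 1 := pow_lt_one₀ (norm_nonneg _) hq (by omega)
  rw [← norm_pow, h1] at h2
  simp at h2

lemma aux_ne (q : ℂ) (hq : ‖q‖ < 1) (n : ℕ) : qPoch q n ≠ 0 :=
  Finset.prod_ne_zero_iff.mpr fun i _ => aux_fac q hq i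

lemma aux_inf_ne (q : ℂ) (hq : ‖q‖ < 1) : qPochInf q ≠ 0 := by
  unfold qPochInf
  simp only [sub_eq_add_neg]
  refine tprod_one_add_ne_zero_of_summable (f := fun n : ℕ => -q ^ (n + 1)) ?_ ?_
  · intro i
    simpa [sub_eq_add_neg] using aux_fac q hq i
  · simp only [norm_neg, norm_pow]
    exact (summable_nat_add_iff 1).mpr (summable_geometric_of_lt_one (norm_nonneg _) hq)

lemma aux_bdd (q : ℂ) (hq : ‖q‖ < 1) : ∃ C : ℝ, 0 ≤ C ∧ ∀ n, ‖(qPoch q n)⁻¹‖ ≤ C := by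
  have h := (aux_mult q hq).inv₀ (aux_inf_ne q hq)
  obtain ⟨C, hC⟩ := (Metric.isBounded_range_of_tendsto _ h).exists_norm_le
  have h2 : ∀ n, ‖(qPoch q n)⁻¹‖ ≤ C := fun n => hC _ ⟨n, rfl⟩
  exact ⟨C, (norm_nonneg _).trans (h2 0), h2⟩

noncomputable def auxE (q : ℂ) (m : ℕ) : ℂ := ∑' n : ℕ, q ^ (n * (m + 1)) * (qPoch q n)⁻¹

lemma aux_term (q : ℂ) (hq : ‖q‖ < 1) (C : ℝ) (hC : ∀ n, ‖(qPoch q n)⁻¹‖ ≤ C) (m n : ℕ) :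
    ‖q ^ (n * (m + 1)) * (qPoch q n)⁻¹‖ ≤ ‖q‖ ^ n * C := by
  rw [norm_mul, norm_pow]
  exact mul_le_mul (pow_le_pow_of_le_one (norm_nonneg _) hq.le (by nlinarith)) (hC n)
    (norm_nonneg _) (by positivity)

lemma aux_summ (q : ℂ) (hq : ‖q‖ < 1) (m : ℕ) :
    Summable fun n : ℕ => q ^ (n * (m + 1)) * (qPoch q n)⁻¹ := by
  obtain ⟨C, _, hC⟩ := aux_bdd q hq
  exact Summable.of_norm_bounded
    ((summable_geometric_of_lt_one (norm_nonneg _) hq).mul_right C) (aux_term q hq C hC m)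

lemma aux_rec (q : ℂ) (hq : ‖q‖ < 1) (m : ℕ) :
    auxE q (m + 1) = (1 - q ^ (m + 1)) * auxE q m := by
  have h : auxE q m - auxE q (m + 1) = q ^ (m + 1) * auxE q m := by
    unfold auxE
    rw [← (aux_summ q hq m).tsum_sub (aux_summ q hq (m + 1)),
      ((aux_summ q hq m).sub (aux_summ q hq (m + 1))).tsum_eq_zero_add, ← tsum_mul_left]
    simp only [zero_mul, pow_zero, sub_self, zero_add]
    refine tsum_congr fun n => ?_
    have h1 : qPoch q (n + 1) = qPoch q n * (1 - q ^ (n + 1)) := Finset.prod_range_succ _ _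
    have h2 := aux_ne q hq n
    have h3 := aux_fac q hq n
    have e1 : q ^ ((n + 1) * (m + 1 + 1)) = q ^ ((n + 1) * (m + 1)) * q ^ (n + 1) := by ring
    have e2 : q ^ ((n + 1) * (m + 1)) = q ^ (m + 1) * q ^ (n * (m + 1)) := by ring
    rw [h1, e1, e2]
    generalize q ^ (n + 1) = x at *
    field_simp
  linear_combination -h

lemma aux_E (q : ℂ) (hq : ‖q‖ < 1) (m : ℕ) : auxE q m = qPoch q m * auxE q 0 := by
  induction m with
  | zero => simp [qPoch]
  | succ m ih =>
    have h1 : qPoch q (m + 1) = qPoch q m * (1 - q ^ (m + 1)) := Finset.prod_range_succ _ _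
    rw [aux_rec q hq, ih, h1]; ring

open Filter Topology in
lemma aux_E_lim (q : ℂ) (hq : ‖q‖ < 1) : Tendsto (auxE q) atTop (𝓝 1) := by
  obtain ⟨C, _, hC⟩ := aux_bdd q hq
  have h := tendsto_tsum_of_dominated_convergence (𝓕 := atTop)
    (f := fun m n : ℕ => q ^ (n * (m + 1)) * (qPoch q n)⁻¹)
    (g := fun n : ℕ => if n = 0 then (1 : ℂ) else 0)
    ((summable_geometric_of_lt_one (norm_nonneg _) hq).mul_right C) ?_
    (Eventually.of_forall fun m => aux_term q hq C hC m)
  · rw [tsum_ite_eq] at h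
    exact h
  · intro n
    by_cases hn : n = 0
    · subst hn
      simp [qPoch]
    · simp only [hn, if_false]
      have : Tendsto (fun m : ℕ => (q ^ n) ^ (m + 1)) atTop (𝓝 0) :=
        (tendsto_pow_atTop_nhds_zero_of_norm_lt_one
          (by rw [norm_pow]; exact pow_lt_one₀ (norm_nonneg _) hq hn)).comp (tendsto_add_atTop_nat 1)
      simpa [pow_mul] using this.mul_const ((qPoch q n)⁻¹)

lemma aux_E_eq (q : ℂ) (hq : ‖q‖ < 1) (m : ℕ) : auxE q m = qPoch q m * (qPochInf q)⁻¹ := by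
  have h1 := (aux_mult q hq).mul_const (auxE q 0)
  have h2 := aux_E_lim q hq
  rw [show auxE q = fun m => qPoch q m * auxE q 0 from funext (aux_E q hq)] at h2
  have h3 := tendsto_nhds_unique h1 h2
  rw [aux_E q hq, eq_inv_of_mul_eq_one_right h3]

noncomputable def auxW (q : ℂ) (m : ℕ) (n : Fin (m + 1) → ℕ) : ℂ :=
  q ^ (∑ i, n i) * ∏ i : Fin m,
    (q ^ (n i.castSucc * n i.succ) * ((qPoch q (n i.castSucc))⁻¹ * (qPoch q (n i.succ))⁻¹))

lemma aux_geo (r : ℝ) (h0 : 0 ≤ r) (h1 : r < 1) (m : ℕ) :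
    Summable fun n : Fin m → ℕ => r ^ (∑ i, n i) := by
  induction m with
  | zero => exact Summable.of_finite
  | succ m ih =>
    rw [← (Fin.consEquiv (fun _ : Fin (m + 1) => ℕ)).summable_iff]
    refine ((summable_geometric_of_lt_one h0 h1).mul_of_nonneg ih
      (fun _ => by positivity) (fun _ => by positivity)).congr ?_
    rintro ⟨a, t⟩
    simp [Fin.consEquiv, Fin.sum_univ_succ, pow_add]

lemma auxW_summ (q : ℂ) (hq : ‖q‖ < 1) (m : ℕ) : Summable (auxW q m) := by
  obtain ⟨C, hC0, hC⟩ := aux_bdd q hq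
  refine Summable.of_norm_bounded
    ((aux_geo ‖q‖ (norm_nonneg _) hq (m + 1)).mul_right ((C * C) ^ m)) fun n => ?_
  unfold auxW
  rw [norm_mul, norm_pow, norm_prod]
  refine mul_le_mul_of_nonneg_left ?_ (by positivity)
  calc _ ≤ ∏ _i : Fin m, (C * C) := by
        refine Finset.prod_le_prod (fun _ _ => norm_nonneg _) fun i _ => ?_
        rw [norm_mul, norm_mul, norm_pow]
        have h1 : ‖q‖ ^ (n i.castSucc * n i.succ) ≤ 1 := pow_le_one₀ (norm_nonneg _) hq.le
        have h2 := mul_le_mul (hC (n i.castSucc)) (hC (n i.succ)) (norm_nonneg _) hC0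
        exact (mul_le_of_le_one_left (by positivity) h1).trans h2
    _ = _ := by simp

lemma auxW_cons (q : ℂ) (m : ℕ) (a : ℕ) (t : Fin (m + 1) → ℕ) :
    auxW q (m + 1) (Fin.cons a t) =
      (q ^ (a * (t 0 + 1)) * (qPoch q a)⁻¹) * ((qPoch q (t 0))⁻¹ * auxW q m t) := by
  unfold auxW
  rw [Fin.prod_univ_succ, Fin.sum_univ_succ]
  simp only [Fin.cons_zero, Fin.cons_succ, Fin.castSucc_zero, Fin.castSucc_succ]
  ring

lemma auxW_sum (q : ℂ) (hq : ‖q‖ < 1) (m : ℕ) :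
    ∑' n, auxW q m n = (1 - q)⁻¹ * ((qPochInf q)⁻¹) ^ m := by
  induction m with
  | zero =>
    rw [← (Equiv.funUnique (Fin 1) ℕ).symm.tsum_eq, pow_zero, mul_one,
      ← tsum_geometric_of_norm_lt_one hq]
    refine tsum_congr fun n => ?_
    simp [auxW]
  | succ m ih =>
    obtain ⟨e, he⟩ : ∃ e : (Fin (m + 1) → ℕ) × ℕ ≃ (Fin (m + 1 + 1) → ℕ),
        ∀ t a, auxW q (m + 1) (e (t, a)) =
          (q ^ (a * (t 0 + 1)) * (qPoch q a)⁻¹) * ((qPoch q (t 0))⁻¹ * auxW q m t) :=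
      ⟨(Equiv.prodComm (Fin (m + 1) → ℕ) ℕ).trans (Fin.consEquiv (fun _ : Fin (m + 2) => ℕ)),
        fun t a => auxW_cons q m a t⟩
    have hs : Summable fun p => auxW q (m + 1) (e p) :=
      (auxW_summ q hq (m + 1)).comp_injective e.injective
    rw [← e.tsum_eq, hs.tsum_prod, pow_succ,
      ← mul_assoc, ← ih, ← tsum_mul_right]
    refine tsum_congr fun t => ?_
    simp only [he]
    rw [tsum_mul_right]
    have := aux_E_eq q hq (t 0)
    unfold auxE at this
    rw [this]
    have := aux_ne q hq (t 0)
    field_simp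

theorem stmt8 (k : ℕ) (hk : 2 ≤ k) (q : ℂ) (hq : ‖q‖ < 1) :
    ∑' n : Fin k → ℕ,
        q ^ ((∑ i, n i) +
              ∑ i : Fin (k - 1),
                n ⟨i.1, by have := i.isLt; omega⟩ * n ⟨i.1 + 1, by have := i.isLt; omega⟩)
          / ∏ i : Fin k, qPoch q (n i) ^ (if i.1 = 0 ∨ i.1 = k - 1 then 1 else 2)
      = 1 / ((1 - q) * qPochInf q ^ (k - 1)) := by
  obtain ⟨l, rfl⟩ : ∃ l, k = l + 2 := ⟨k - 2, by omega⟩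
  have h := auxW_sum q hq (l + 1)
  have hr : 1 / ((1 - q) * qPochInf q ^ (l + 2 - 1)) = (1 - q)⁻¹ * ((qPochInf q)⁻¹) ^ (l + 1) := by
    simp [mul_comm]
  rw [hr, ← h]
  refine tsum_congr fun n => ?_
  unfold auxW
  rw [Finset.prod_mul_distrib, Finset.prod_mul_distrib, Finset.prod_pow_eq_pow_sum, ← mul_assoc,
    ← pow_add, div_eq_mul_inv]
  congr 1
  rw [Finset.prod_inv_distrib, Finset.prod_inv_distrib, ← mul_inv]
  congr 1
  rw [Fin.prod_univ_succ, Fin.prod_univ_castSucc, Fin.prod_univ_succ (n := l),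
    Fin.prod_univ_castSucc (n := l)]
  have hm : ∀ i : Fin l, (if (i.castSucc.succ : Fin (l + 2)).1 = 0 ∨
      (i.castSucc.succ : Fin (l + 2)).1 = l + 2 - 1 then 1 else 2) = 2 := by
    intro i
    have := i.isLt
    rw [if_neg]
    simp
    omega
  simp only [hm, Finset.prod_pow]
  simp
  ring
end
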